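/- arXiv:1407.0539 — 2 statements merged into one kernel-verified Lean document; each statement's English description precedes it below -/
import Mathlib

section
/- Let {P₀, …, P_m} be a symmetric Clifford system on ℝ^{2l} and 2 ≤ i ≤ m. Then for each choice of sign ε = ±1, the set {x ∈ S^{2l−1} : Σ_{α=0}^{i} ⟨P_αx, x⟩² = 1 and ⟨P_ix, x⟩ = ε} equals {x ∈ S^{2l−1} : P_ix = εx}, i.e. the focal set 𝒱_ε of the isoparametric function g_i on N_i is the intersection of the ε-eigenspace of P_i with the unit sphere. -/
open Matrix

/-- A symmetric matrix is self-adjoint for the dot product. -/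
theorem Matrix.IsSymm.mulVec_dotProduct {n : Type*} [Fintype n] {A : Matrix n n ℝ}
    (hA : A.IsSymm) (x y : n → ℝ) : A *ᵥ x ⬝ᵥ y = x ⬝ᵥ A *ᵥ y := by
  rw [dotProduct_mulVec, ← mulVec_transpose, hA.eq]

/-- A unit vector `x` with `⟨Ax, x⟩ = ε = ±1`, for a symmetric involution `A`, is an
eigenvector of `A` for `ε`. -/
theorem mulVec_eq_smul_of_dotProduct_eq {n : Type*} [Fintype n] [DecidableEq n]
    {A : Matrix n n ℝ} (hA : A.IsSymm) (hsq : A * A = 1) {ε : ℝ} (hε : ε * ε = 1)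
    {x : n → ℝ} (hx : x ⬝ᵥ x = 1) (h : A *ᵥ x ⬝ᵥ x = ε) : A *ᵥ x = ε • x := by
  have hAA : A *ᵥ x ⬝ᵥ A *ᵥ x = 1 := by
    rw [hA.mulVec_dotProduct, mulVec_mulVec, hsq, one_mulVec, hx]
  rw [← sub_eq_zero, ← dotProduct_self_eq_zero]
  simp only [sub_dotProduct, dotProduct_sub, smul_dotProduct, dotProduct_smul, smul_eq_mul,
    hAA, hx, h, dotProduct_comm x (A *ᵥ x)]
  linarith

/-- If `B` anticommutes with the symmetric matrix `A`, then `⟨Bx, x⟩ = 0` for every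
eigenvector `x` of `A` with nonzero eigenvalue. -/
theorem mulVec_dotProduct_eq_zero_of_anticommute {n : Type*} [Fintype n]
    {A B : Matrix n n ℝ} (hA : A.IsSymm) (hAB : B * A + A * B = 0) {ε : ℝ} (hε : ε ≠ 0)
    {x : n → ℝ} (hx : A *ᵥ x = ε • x) : B *ᵥ x ⬝ᵥ x = 0 := by
  have h : (B * A + A * B) *ᵥ x ⬝ᵥ x = 0 := by simp [hAB]
  rw [add_mulVec, add_dotProduct, ← mulVec_mulVec, ← mulVec_mulVec, hA.mulVec_dotProduct, hx,
    mulVec_smul, smul_dotProduct, dotProduct_smul, smul_eq_mul] at h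
  have h' : ε * (B *ᵥ x ⬝ᵥ x) = 0 := by linarith
  exact (mul_eq_zero.mp h').resolve_left hε

/-- For a symmetric Clifford system `{P₀, …, P_m}` on `ℝ^{2l}` and `2 ≤ i ≤ m`,
for each sign `ε = ±1`, the focal set
`{x ∈ S^{2l-1} : ∑_{α=0}^{i} ⟨P_αx,x⟩² = 1, ⟨P_ix,x⟩ = ε}` equals
`{x ∈ S^{2l-1} : P_i x = ε x}`. -/
theorem stmt_3 (l m i : ℕ) (hi2 : 2 ≤ i) (him : i ≤ m)
    (P : ℕ → Matrix (Fin (2 * l)) (Fin (2 * l)) ℝ)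
    (hs : ∀ α ≤ m, (P α).IsSymm)
    (hc : ∀ α ≤ m, ∀ β ≤ m,
      P α * P β + P β * P α = if α = β then (2 : ℝ) • 1 else 0)
    (ε : ℝ) (hε : ε = 1 ∨ ε = -1) :
    {x : Fin (2 * l) → ℝ | x ⬝ᵥ x = 1 ∧
        (∑ α ∈ Finset.range (i + 1), ((P α).mulVec x ⬝ᵥ x) ^ 2 = 1) ∧
        (P i).mulVec x ⬝ᵥ x = ε}
    = {x : Fin (2 * l) → ℝ | x ⬝ᵥ x = 1 ∧ (P i).mulVec x = ε • x} := by
  have hε2 : ε * ε = 1 := by rcases hε with rfl | rfl <;> norm_num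
  have hε0 : ε ≠ 0 := by rintro rfl; simp at hε2
  have hsq : P i * P i = 1 := by
    have h := hc i him i him
    rw [if_pos rfl, ← two_smul ℝ] at h
    exact smul_right_injective _ (two_ne_zero : (2 : ℝ) ≠ 0) h
  ext x
  constructor
  · rintro ⟨hx, -, h⟩
    exact ⟨hx, mulVec_eq_smul_of_dotProduct_eq (hs i him) hsq hε2 hx h⟩
  · rintro ⟨hx, h⟩
    have hi : (P i).mulVec x ⬝ᵥ x = ε := by
      rw [h, smul_dotProduct, hx, smul_eq_mul, mul_one]
    refine ⟨hx, ?_, hi⟩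
    rw [Finset.sum_range_succ, hi, Finset.sum_eq_zero, zero_add, sq, hε2]
    intro α hα
    have hαi : α < i := Finset.mem_range.mp hα
    have hanti := hc α (hαi.le.trans him) i him
    rw [if_neg hαi.ne] at hanti
    rw [mulVec_dotProduct_eq_zero_of_anticommute (hs i him) hanti hε0 h, sq, zero_mul]
end

section
/- Let {P₀, …, P_m} be a symmetric Clifford system on ℝ^{2l}, 0 ≤ i ≤ m−1, and let y ∈ S^{2l−1} satisfy P_{i+1}y = y and ⟨P_αy, y⟩ = 0 for all 0 ≤ α ≤ i. Then the fiber of the focal map φ_{π/4}(x) = (x + P_{i+1}x)/√2 over y is given by {x ∈ M_{i+1} : x + P_{i+1}x = √2·y} = {(y + z)/√2 : z ∈ ℝ^{2l}, |z| = 1, P_{i+1}z = −z, and ⟨z, P_αy⟩ = 0 for all 0 ≤ α ≤ i}. In particular, this fiber is a round sphere of radius 1/√2 (of dimension l−i−2 when the constraints are independent). -/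
open Matrix Real

theorem Matrix.IsSymm.mulVec_dotProduct_comm {n R : Type*} [Fintype n] [CommRing R]
    {A : Matrix n n R} (hA : A.IsSymm) (u v : n → R) :
    A.mulVec u ⬝ᵥ v = u ⬝ᵥ A.mulVec v := by
  rw [dotProduct_mulVec, ← mulVec_transpose, hA.eq]

/-- Eigenvectors of a symmetric matrix with eigenvalues `1` and `-1` are orthogonal. -/
theorem dotProduct_eq_zero_of_mulVec_eq_of_mulVec_eq_neg {n : Type*} [Fintype n]
    {Q : Matrix n n ℝ} (hQ : Q.IsSymm) {y z : n → ℝ}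
    (hy : Q.mulVec y = y) (hz : Q.mulVec z = -z) : y ⬝ᵥ z = 0 := by
  have h := hQ.mulVec_dotProduct_comm y z
  rw [hy, hz, dotProduct_neg] at h
  linarith

/-- If `A` anticommutes with the symmetric matrix `Q`, then the quadratic form of `A` vanishes
on the `-1`-eigenspace of `Q`. -/
theorem mulVec_dotProduct_self_eq_zero_of_anticomm {n : Type*} [Fintype n]
    {A Q : Matrix n n ℝ} (hQ : Q.IsSymm) (hAQ : A * Q + Q * A = 0) {z : n → ℝ}
    (hz : Q.mulVec z = -z) : A.mulVec z ⬝ᵥ z = 0 := by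
  have h : A.mulVec (Q.mulVec z) + Q.mulVec (A.mulVec z) = 0 := by
    rw [mulVec_mulVec, mulVec_mulVec, ← add_mulVec, hAQ, zero_mulVec]
  have h' := congrArg (· ⬝ᵥ z) h
  simp only [add_dotProduct, zero_dotProduct, hQ.mulVec_dotProduct_comm, hz, mulVec_neg,
    neg_dotProduct, dotProduct_neg] at h'
  linarith

theorem inv_sqrt_two_smul_dotProduct_inv_sqrt_two_smul {n : Type*} [Fintype n] (u v : n → ℝ) :
    (√2)⁻¹ • u ⬝ᵥ (√2)⁻¹ • v = (u ⬝ᵥ v) / 2 := by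
  have h : (√2)⁻¹ * (√2)⁻¹ = (2 : ℝ)⁻¹ := by
    rw [← mul_inv, Real.mul_self_sqrt zero_le_two]
  rw [smul_dotProduct, dotProduct_smul, smul_eq_mul, smul_eq_mul, ← mul_assoc, h]
  ring

/-- For a symmetric Clifford system `{P₀, …, P_m}` on `ℝ^{2l}`, `0 ≤ i ≤ m-1`,
and `y ∈ S^{2l-1}` with `P_{i+1}y = y` and `⟨P_αy, y⟩ = 0` for `0 ≤ α ≤ i`, the
fiber of the focal map `φ_{π/4}(x) = (x + P_{i+1}x)/√2` over `y` is
`{(y+z)/√2 : |z| = 1, P_{i+1}z = -z, ⟨z, P_αy⟩ = 0 ∀ 0 ≤ α ≤ i}`. -/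
theorem stmt_10 (l m i : ℕ) (hi : i + 1 ≤ m)
    (P : ℕ → Matrix (Fin (2 * l)) (Fin (2 * l)) ℝ)
    (hs : ∀ α ≤ m, (P α).IsSymm)
    (hc : ∀ α ≤ m, ∀ β ≤ m,
      P α * P β + P β * P α = if α = β then (2 : ℝ) • 1 else 0)
    (y : Fin (2 * l) → ℝ) (hy : y ⬝ᵥ y = 1)
    (hy1 : (P (i + 1)).mulVec y = y)
    (hy0 : ∀ α ≤ i, (P α).mulVec y ⬝ᵥ y = 0) :
    {x : Fin (2 * l) → ℝ | x ⬝ᵥ x = 1 ∧ (∀ α ≤ i + 1, (P α).mulVec x ⬝ᵥ x = 0) ∧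
        x + (P (i + 1)).mulVec x = Real.sqrt 2 • y}
    = {w : Fin (2 * l) → ℝ | ∃ z : Fin (2 * l) → ℝ, z ⬝ᵥ z = 1 ∧
        (P (i + 1)).mulVec z = -z ∧ (∀ α ≤ i, z ⬝ᵥ (P α).mulVec y = 0) ∧
        w = (Real.sqrt 2)⁻¹ • (y + z)} := by
  set Q := P (i + 1) with hQ
  have hQs : Q.IsSymm := hs _ hi
  have hanti : ∀ α ≤ i, P α * Q + Q * P α = 0 := fun α hα => by
    rw [hQ, hc α (by omega) _ hi, if_neg (by omega)]
  have h2 : √2 ≠ 0 := by positivity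
  have key : ∀ z, Q.mulVec z = -z →
      ((√2)⁻¹ • (y + z) ⬝ᵥ (√2)⁻¹ • (y + z) = (1 + z ⬝ᵥ z) / 2) ∧
      (∀ α ≤ i, (P α).mulVec ((√2)⁻¹ • (y + z)) ⬝ᵥ (√2)⁻¹ • (y + z) = z ⬝ᵥ (P α).mulVec y) ∧
      (Q.mulVec ((√2)⁻¹ • (y + z)) ⬝ᵥ (√2)⁻¹ • (y + z) = (1 - z ⬝ᵥ z) / 2) ∧
      (√2)⁻¹ • (y + z) + Q.mulVec ((√2)⁻¹ • (y + z)) = √2 • y := by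
    intro z hz
    have hyz := dotProduct_eq_zero_of_mulVec_eq_of_mulVec_eq_neg hQs hy1 hz
    have hzy : z ⬝ᵥ y = 0 := by rw [dotProduct_comm, hyz]
    refine ⟨?_, fun α hα => ?_, ?_, ?_⟩
    · rw [inv_sqrt_two_smul_dotProduct_inv_sqrt_two_smul]
      simp only [add_dotProduct, dotProduct_add, hy, hyz, hzy]
      ring
    · have hzz := mulVec_dotProduct_self_eq_zero_of_anticomm hQs (hanti α hα) hz
      rw [mulVec_smul, inv_sqrt_two_smul_dotProduct_inv_sqrt_two_smul]
      simp only [mulVec_add, add_dotProduct, dotProduct_add, hy0 α hα, hzz,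
        (hs α (by omega)).mulVec_dotProduct_comm z y, dotProduct_comm ((P α).mulVec y) z]
      ring
    · rw [mulVec_smul, inv_sqrt_two_smul_dotProduct_inv_sqrt_two_smul]
      simp only [mulVec_add, hy1, hz, add_dotProduct, dotProduct_add, neg_dotProduct, hy, hyz, hzy]
      ring
    · rw [mulVec_smul, mulVec_add, hy1, hz, ← smul_add, inv_smul_eq_iff₀ h2, smul_smul,
        Real.mul_self_sqrt zero_le_two, two_smul]
      abel
  ext x
  constructor
  · rintro ⟨hx, hPx, hfib⟩
    have hx' : x = (√2)⁻¹ • (y + (√2 • x - y)) := by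
      rw [add_sub_cancel, inv_smul_smul₀ h2]
    have hz : Q.mulVec (√2 • x - y) = -(√2 • x - y) := by
      have hQx : Q.mulVec x = √2 • y - x := eq_sub_of_add_eq' hfib
      rw [mulVec_sub, mulVec_smul, hy1, hQx, smul_sub, smul_smul,
        Real.mul_self_sqrt zero_le_two, two_smul]
      abel
    obtain ⟨hnorm, hquad, -, -⟩ := key _ hz
    rw [← hx'] at hnorm hquad
    refine ⟨√2 • x - y, by linarith, hz, fun α hα => ?_, hx'⟩
    rw [← hquad α hα, hPx α (by omega)]
  · rintro ⟨z, hzz, hz, hzP, rfl⟩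
    obtain ⟨hnorm, hquad, hQquad, hfib⟩ := key z hz
    refine ⟨by rw [hnorm, hzz]; norm_num, fun α hα => ?_, hfib⟩
    rcases Nat.le_succ_iff.mp hα with h | rfl
    · rw [hquad α h, hzP α h]
    · rw [← hQ, hQquad, hzz]; norm_num
end
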